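/- arXiv:0707.0831 — 2 statements merged into one kernel-verified Lean document; each statement's English description precedes it below -/
import Mathlib

section
/- Let (α,θ) ∈ Ω and let φ, β, G, U be as in the context. Then β and G are odd functions, and for all u ∈ ℝ one has β(u+U) = β(u) + β(U) and G(u+U) = G(u) + G(U). -/
open Real Filter

noncomputable def Ccoef (α θ : ℝ) : ℝ := Real.sin (2 * θ) / (2 * α)

noncomputable def Ppoly (α θ x : ℝ) : ℝ :=
  α ^ 2 + Real.cos (2 * θ) * x ^ 2 - Ccoef α θ ^ 2 * x ^ 4

noncomputable def thetaPlus (α : ℝ) : ℝ :=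
  if 1 < α then Real.pi / 2 else (1 / 2) * Real.arccos (1 - 2 * α ^ 2)

def inOmega (α θ : ℝ) : Prop := 0 < α ∧ -thetaPlus α < θ ∧ θ < thetaPlus α

noncomputable def Lint (α θ : ℝ) : ℝ :=
  ∫ x in (-1 : ℝ)..1,
    (2 * α * Ccoef α θ ^ 2 * x ^ 2 - α * Real.cos (2 * θ)
        + Ccoef α θ ^ 2 * x ^ 2 * Real.sqrt (Ppoly α θ x)) /
      (Real.sqrt ((1 - x ^ 2) * Ppoly α θ x) * (α + Real.sqrt (Ppoly α θ x)))

/-- Wirtinger derivative `f_z = (f_u - i f_v)/2` of a map `f : ℝ² → ℂ`. -/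
noncomputable def wz (f : ℝ × ℝ → ℂ) (p : ℝ × ℝ) : ℂ :=
  (deriv (fun t => f (t, p.2)) p.1 - Complex.I * deriv (fun t => f (p.1, t)) p.2) / 2

/-- Wirtinger derivative `f_z̄ = (f_u + i f_v)/2` of a map `f : ℝ² → ℂ`. -/
noncomputable def wzbar (f : ℝ × ℝ → ℂ) (p : ℝ × ℝ) : ℂ :=
  (deriv (fun t => f (t, p.2)) p.1 + Complex.I * deriv (fun t => f (p.1, t)) p.2) / 2

/-- An antiderivative vanishing at `0` of an even function is odd. -/
theorem odd_of_hasDerivAt_even {F f : ℝ → ℝ} (hF : ∀ u, HasDerivAt F (f u) u) (h0 : F 0 = 0)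
    (hf : ∀ u, f (-u) = f u) (u : ℝ) : F (-u) = -F u := by
  have hd : ∀ v, HasDerivAt (fun x => F (-x) + F x) 0 v := fun v => by
    have h := ((hF (-v)).scomp v (hasDerivAt_neg v)).add (hF v)
    exact h.congr_deriv (by simp [hf v])
  have h := is_const_of_deriv_eq_zero (fun v => (hd v).differentiableAt)
    (fun v => (hd v).deriv) u 0
  simp only [neg_zero, h0, add_zero] at h
  linarith

/-- An antiderivative vanishing at `0` of a `U`-periodic function is additive under translation
by `U`. -/
theorem add_period_of_hasDerivAt_periodic {F f : ℝ → ℝ} {U : ℝ}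
    (hF : ∀ u, HasDerivAt F (f u) u) (h0 : F 0 = 0) (hf : ∀ u, f (u + U) = f u) (u : ℝ) :
    F (u + U) = F u + F U := by
  have hd : ∀ v, HasDerivAt (fun x => F (x + U) - F x) 0 v := fun v => by
    have h := ((hF (v + U)).comp_add_const v U).sub (hF v)
    exact h.congr_deriv (by simp [hf v])
  have h := is_const_of_deriv_eq_zero (fun v => (hd v).differentiableAt)
    (fun v => (hd v).deriv) u 0
  simp only [zero_add, h0, sub_zero] at h
  linarith

/-- A solution of the autonomous equation `φ' = -g(φ)`, with `g` positive, continuous and even,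
is odd if it vanishes at `0`. -/
theorem odd_of_autonomous {φ g : ℝ → ℝ} (hg : Continuous g) (hpos : ∀ x, 0 < g x)
    (heven : ∀ x, g (-x) = g x) (hφ : ∀ u, HasDerivAt φ (-g (φ u)) u) (h0 : φ 0 = 0) (u : ℝ) :
    φ (-u) = -φ u := by
  have hc : Continuous fun x => (g x)⁻¹ := hg.inv₀ fun x => (hpos x).ne'
  obtain ⟨H, hH, hH0⟩ : ∃ H : ℝ → ℝ, (∀ x, HasDerivAt H (g x)⁻¹ x) ∧ H 0 = 0 :=
    ⟨fun x => ∫ t in (0 : ℝ)..x, (g t)⁻¹, fun x => (hc.integral_hasStrictDerivAt 0 x).hasDerivAt,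
      by simp⟩
  have hmono : StrictMono H := strictMono_of_hasDerivAt_pos hH fun x => inv_pos.2 (hpos x)
  have hodd := odd_of_hasDerivAt_even hH hH0 fun x => by rw [heven]
  have htime : ∀ v, H (φ v) = -v := fun v => by
    have hd : ∀ w, HasDerivAt (fun x => H (φ x) + x) 0 w := fun w => by
      have h := ((hH (φ w)).comp w (hφ w)).add (hasDerivAt_id w)
      exact h.congr_deriv (by simp [(hpos (φ w)).ne'])
    have h := is_const_of_deriv_eq_zero (fun w => (hd w).differentiableAt)
      (fun w => (hd w).deriv) v 0
    simp only [h0, hH0, add_zero] at h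
    linarith
  apply hmono.injective
  rw [hodd, htime, htime]

theorem one_sub_lt_cos_of_inOmega {α θ : ℝ} (h : inOmega α θ) :
    1 - 2 * α ^ 2 < Real.cos (2 * θ) := by
  obtain ⟨hα, h1, h2⟩ := h
  rw [← Real.cos_abs]
  have habs : |2 * θ| < 2 * thetaPlus α := abs_lt.2 ⟨by linarith, by linarith⟩
  unfold thetaPlus at habs
  split_ifs at habs with hα1
  · have h3 : Real.cos Real.pi < Real.cos |2 * θ| :=
      Real.cos_lt_cos_of_nonneg_of_le_pi (abs_nonneg _) le_rfl (by linarith)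
    rw [Real.cos_pi] at h3
    nlinarith
  · have h3 : Real.cos (Real.arccos (1 - 2 * α ^ 2)) < Real.cos |2 * θ| :=
      Real.cos_lt_cos_of_nonneg_of_le_pi (abs_nonneg _) (Real.arccos_le_pi _) (by linarith)
    rwa [Real.cos_arccos (by nlinarith) (by nlinarith)] at h3

theorem Ppoly_pos_of_inOmega {α θ x : ℝ} (h : inOmega α θ) (hx : x ^ 2 ≤ 1) :
    0 < Ppoly α θ x := by
  have hα := h.1
  have hc := one_sub_lt_cos_of_inOmega h
  have hone : 0 < Ppoly α θ 1 := by
    have heq : Ppoly α θ 1 =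
        (2 * α ^ 2 + Real.cos (2 * θ) - 1) * (2 * α ^ 2 + Real.cos (2 * θ) + 1) /
          (4 * α ^ 2) := by
      unfold Ppoly Ccoef
      rw [div_pow, Real.sin_sq]
      field_simp
      ring
    rw [heq]
    exact div_pos (mul_pos (by linarith) (by linarith)) (by positivity)
  have hconc : Ppoly α θ x = (1 - x ^ 2) * α ^ 2 + x ^ 2 * Ppoly α θ 1
      + Ccoef α θ ^ 2 * (x ^ 2 * (1 - x ^ 2)) := by
    unfold Ppoly
    ring
  have h1 : 0 ≤ 1 - x ^ 2 := by linarith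
  have h2 : 0 ≤ Ccoef α θ ^ 2 * (x ^ 2 * (1 - x ^ 2)) := by positivity
  rcases (sq_nonneg x).eq_or_lt with h0 | h0
  · rw [hconc, ← h0]
    simp only [sub_zero, one_mul, zero_mul, mul_zero, add_zero]
    positivity
  · rw [hconc]
    have := mul_pos h0 hone
    have := mul_nonneg h1 (sq_nonneg α)
    linarith

/-- `β` and `G` are odd, and `β(u+U) = β(u) + β(U)`, `G(u+U) = G(u) + G(U)` for all `u`. -/
theorem statement_3 {α θ : ℝ} (hΩ : inOmega α θ) (φ φ' β G : ℝ → ℝ)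
    (hφ : ∀ u, HasDerivAt φ (φ' u) u) (hφ'c : Continuous φ')
    (hode : ∀ u, (φ' u) ^ 2 = Ppoly α θ (Real.cos (φ u)))
    (hφ0 : φ 0 = 0) (hφ'0 : φ' 0 ≤ 0)
    (hβ : ∀ u, HasDerivAt β (Ccoef α θ * Real.cos (φ u) ^ 2) u) (hβ0 : β 0 = 0)
    (hG : ∀ u, HasDerivAt G
      ((Ccoef α θ ^ 2 * Real.cos (φ u) ^ 2 - Real.cos (2 * θ)) / (α - φ' u)) u)
    (hG0 : G 0 = 0)
    (U : ℝ) (hU : 0 < U) (hUper : ∀ u, φ (u + U) = φ u - Real.pi) :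
    (∀ u, β (-u) = -β u) ∧ (∀ u, G (-u) = -G u) ∧
    (∀ u, β (u + U) = β u + β U) ∧ (∀ u, G (u + U) = G u + G U) := by
  have hP : ∀ x, 0 < Ppoly α θ (Real.cos x) := fun x =>
    Ppoly_pos_of_inOmega hΩ (Real.cos_sq_le_one x)
  have hne : ∀ u, φ' u ≠ 0 := fun u hu => by
    have h := hode u
    rw [hu] at h
    have := hP (φ u)
    norm_num at h
    linarith
  have hneg : ∀ u, φ' u < 0 := fun u => by
    by_contra hu
    obtain ⟨v, hv⟩ := mem_range_of_exists_le_of_exists_ge hφ'c ⟨0, hφ'0⟩ ⟨u, not_lt.1 hu⟩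
    exact hne v hv
  have hφ'eq : ∀ u, φ' u = -Real.sqrt (Ppoly α θ (Real.cos (φ u))) := fun u => by
    rw [← hode u, Real.sqrt_sq_eq_abs, abs_of_neg (hneg u), neg_neg]
  have hodd : ∀ u, φ (-u) = -φ u := by
    refine odd_of_autonomous (g := fun x => Real.sqrt (Ppoly α θ (Real.cos x))) ?_
      (fun x => Real.sqrt_pos.2 (hP x)) (fun x => by rw [Real.cos_neg])
      (fun u => hφ'eq u ▸ hφ u) hφ0
    unfold Ppoly
    fun_prop
  have hcos_neg : ∀ u, Real.cos (φ (-u)) = Real.cos (φ u) := fun u => by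
    rw [hodd, Real.cos_neg]
  have hcos_add : ∀ u, Real.cos (φ (u + U)) = -Real.cos (φ u) := fun u => by
    rw [hUper, Real.cos_sub_pi]
  have hφ'_neg : ∀ u, φ' (-u) = φ' u := fun u => by
    rw [hφ'eq, hφ'eq u, hcos_neg]
  have hφ'_add : ∀ u, φ' (u + U) = φ' u := fun u => by
    rw [hφ'eq, hφ'eq u, hcos_add, Ppoly, Ppoly, neg_sq, Even.neg_pow (by decide)]
  exact ⟨odd_of_hasDerivAt_even hβ hβ0 fun u => by rw [hcos_neg],
    odd_of_hasDerivAt_even hG hG0 fun u => by rw [hcos_neg, hφ'_neg],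
    add_period_of_hasDerivAt_periodic hβ hβ0 fun u => by rw [hcos_add, neg_sq],
    add_period_of_hasDerivAt_periodic hG hG0 fun u => by rw [hcos_add, hφ'_add, neg_sq]⟩
end

section
/- Let θ̃ : (0,∞) → ℝ be any function such that for every α > 0, θ̃(α) ∈ (0, θ⁺_α) ∩ (0, π/4) and L(α, θ̃(α)) = 0. Then θ̃(α) tends to π/4 as α → +∞. -/
open Real Filter

open MeasureTheory intervalIntegral

lemma Ccoef_sq_le {α : ℝ} (hα : 1 ≤ α) (θ : ℝ) : Ccoef α θ ^ 2 * (4 * α ^ 2) ≤ 1 := by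
  have h : Ccoef α θ ^ 2 * (4 * α ^ 2) = sin (2 * θ) ^ 2 := by
    unfold Ccoef
    field_simp
    ring
  rw [h]
  exact sin_sq_le_one _

lemma Ccoef_sq_le_quarter {α : ℝ} (hα : 1 ≤ α) (θ : ℝ) : Ccoef α θ ^ 2 ≤ 1 / 4 := by
  nlinarith [Ccoef_sq_le hα θ, sq_nonneg (Ccoef α θ), sq_nonneg (α - 1)]

lemma Ppoly_pos {α θ x : ℝ} (hα : 1 ≤ α) (hc : 0 ≤ cos (2 * θ)) (hx : x ^ 2 ≤ 1) :
    0 < Ppoly α θ x := by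
  unfold Ppoly
  have hx4 : x ^ 4 ≤ 1 := by nlinarith [sq_nonneg x]
  have h : Ccoef α θ ^ 2 * x ^ 4 ≤ 1 / 4 * 1 :=
    mul_le_mul (Ccoef_sq_le_quarter hα θ) hx4 (by positivity) (by norm_num)
  nlinarith [mul_nonneg hc (sq_nonneg x)]

lemma sqrt_Ppoly_le {α θ x : ℝ} (hα : 1 ≤ α) (hx : x ^ 2 ≤ 1) :
    √(Ppoly α θ x) ≤ 2 * α := by
  apply Real.sqrt_le_iff.2 ⟨by positivity, ?_⟩
  unfold Ppoly
  have h : cos (2 * θ) * x ^ 2 ≤ 1 := by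
    nlinarith [cos_le_one (2 * θ), sq_nonneg x]
  have h' : 0 ≤ Ccoef α θ ^ 2 * x ^ 4 := by positivity
  nlinarith

lemma Lint_numerator_neg {α θ x : ℝ} (hα : 1 ≤ α) (hc : 1 / α ^ 2 < cos (2 * θ))
    (hx : x ^ 2 ≤ 1) :
    2 * α * Ccoef α θ ^ 2 * x ^ 2 - α * cos (2 * θ)
      + Ccoef α θ ^ 2 * x ^ 2 * √(Ppoly α θ x) < 0 := by
  have hα0 : 0 < α := by linarith
  have hcx : Ccoef α θ ^ 2 * x ^ 2 ≤ Ccoef α θ ^ 2 :=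
    mul_le_of_le_one_right (sq_nonneg _) hx
  have h1 : Ccoef α θ ^ 2 * x ^ 2 * √(Ppoly α θ x) ≤ Ccoef α θ ^ 2 * (2 * α) :=
    mul_le_mul hcx (sqrt_Ppoly_le hα hx) (sqrt_nonneg _) (sq_nonneg _)
  have h2 : 2 * α * (Ccoef α θ ^ 2 * x ^ 2) ≤ 2 * α * Ccoef α θ ^ 2 :=
    mul_le_mul_of_nonneg_left hcx (by positivity)
  rw [div_lt_iff₀ (by positivity)] at hc
  have h3 : α * (4 * α * Ccoef α θ ^ 2) < α * (α * cos (2 * θ)) := by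
    nlinarith [Ccoef_sq_le hα θ]
  have h4 := lt_of_mul_lt_mul_left h3 hα0.le
  linarith

lemma intervalIntegrable_Lint {α θ : ℝ} (hα : 1 ≤ α) (hc : 0 ≤ cos (2 * θ)) :
    IntervalIntegrable (fun x : ℝ =>
      (2 * α * Ccoef α θ ^ 2 * x ^ 2 - α * Real.cos (2 * θ)
        + Ccoef α θ ^ 2 * x ^ 2 * Real.sqrt (Ppoly α θ x)) /
      (Real.sqrt ((1 - x ^ 2) * Ppoly α θ x) * (α + Real.sqrt (Ppoly α θ x))))
      volume (-1) 1 := by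
  have hα0 : 0 < α := by linarith
  have hP : Continuous (Ppoly α θ) := by
    unfold Ppoly
    fun_prop
  have hg : ContinuousOn (fun x : ℝ =>
      (2 * α * Ccoef α θ ^ 2 * x ^ 2 - α * Real.cos (2 * θ)
        + Ccoef α θ ^ 2 * x ^ 2 * √(Ppoly α θ x)) /
      (√(Ppoly α θ x) * (α + √(Ppoly α θ x)))) (Set.uIcc (-1) 1) := by
    apply ContinuousOn.div (by fun_prop) (by fun_prop)
    intro x hx
    rw [Set.uIcc_of_le (by norm_num)] at hx
    have := sqrt_pos.2 (Ppoly_pos (x := x) hα hc (by nlinarith [hx.1, hx.2]))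
    positivity
  refine (Polynomial.Chebyshev.intervalIntegrable_sqrt_one_sub_sq_inv.mul_continuousOn
    hg).congr_uIoo ?_
  intro x hx
  rw [Set.uIoo_of_le (by norm_num)] at hx
  have hx2 : 0 ≤ 1 - x ^ 2 := by nlinarith [hx.1, hx.2]
  simp only [sqrt_mul hx2, sqrt_inv]
  rw [inv_mul_eq_div, div_div]
  congr 1
  ring

lemma Lint_neg {α θ : ℝ} (hα : 1 ≤ α) (hc : 1 / α ^ 2 < cos (2 * θ)) : Lint α θ < 0 := by
  have hc0 : 0 ≤ cos (2 * θ) := le_trans (by positivity) hc.le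
  have h := intervalIntegral_pos_of_pos_on (intervalIntegrable_Lint hα hc0).neg
    (fun x hx => ?_) (by norm_num)
  · simp only [Pi.neg_apply, intervalIntegral.integral_neg] at h
    exact neg_pos.1 h
  · have hx2 : 0 < 1 - x ^ 2 := by nlinarith [hx.1, hx.2]
    have hP := Ppoly_pos (x := x) hα hc0 (by linarith)
    have hα0 : 0 < α := by linarith
    exact neg_pos.2 (div_neg_of_neg_of_pos (Lint_numerator_neg hα hc (by linarith))
      (mul_pos (sqrt_pos.2 (mul_pos hx2 hP)) (by positivity)))

/-- Any selection `θ̃(α)` of zeros of `L(α,·)` in `(0, θ⁺_α) ∩ (0, π/4)` tends to `π/4`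
as `α → +∞`. -/
theorem statement_10 (θt : ℝ → ℝ)
    (h : ∀ α : ℝ, 0 < α →
      θt α ∈ Set.Ioo 0 (thetaPlus α) ∩ Set.Ioo 0 (Real.pi / 4) ∧ Lint α (θt α) = 0) :
    Filter.Tendsto θt Filter.atTop (nhds (Real.pi / 4)) := by
  have hcos : Tendsto (fun α => cos (2 * θt α)) atTop (nhds 0) := by
    have hinv : Tendsto (fun α : ℝ => 1 / α ^ 2) atTop (nhds 0) := by
      simpa [Function.comp_def] using tendsto_inv_atTop_zero.comp (tendsto_pow_atTop (α := ℝ) two_ne_zero)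
    refine tendsto_of_tendsto_of_tendsto_of_le_of_le' tendsto_const_nhds hinv ?_ ?_
    · filter_upwards [eventually_ge_atTop 1] with α hα
      obtain ⟨⟨-, h0, h1⟩, -⟩ := h α (by linarith)
      exact cos_nonneg_of_neg_pi_div_two_le_of_le (by linarith [pi_pos]) (by linarith)
    · filter_upwards [eventually_ge_atTop 1] with α hα
      by_contra! hlt
      exact (Lint_neg hα hlt).ne (h α (by linarith)).2
  have hlim := ((continuous_arccos.tendsto 0).comp hcos).div_const 2
  rw [arccos_zero, div_div, show (2 : ℝ) * 2 = 4 by norm_num] at hlim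
  refine hlim.congr' ?_
  filter_upwards [eventually_ge_atTop 1] with α hα
  obtain ⟨⟨-, h0, h1⟩, -⟩ := h α (by linarith)
  rw [Function.comp_apply, arccos_cos (by linarith) (by linarith [pi_pos])]
  ring
end
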